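/- If condition (★) fails, i.e. there exist a subset I ⊆ {1,…,k} with ∑_{i∈I} n_i = n and indices i ∈ I, j ∉ I such that U_i and U_j are isomorphic as Γ-modules, then Fix(φ) is an infinite set. -/

import Mathlib

open Module

namespace BZSVFix

variable {Γ : Type*} [Group Γ]

/-- A subspace `U ⊆ ℂ^d` is `Γ`-invariant for the representation `φ`. -/
def IsInvariant {d : ℕ} (φ : Representation ℂ Γ (Fin d → ℂ))
    (U : Submodule ℂ (Fin d → ℂ)) : Prop :=
  ∀ γ : Γ, ∀ x ∈ U, φ γ x ∈ U

/-- A `Γ`-invariant subspace is irreducible if it is nonzero and contains no `Γ`-invariant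
subspace other than `0` and itself. -/
def IsIrreducibleInv {d : ℕ} (φ : Representation ℂ Γ (Fin d → ℂ))
    (U : Submodule ℂ (Fin d → ℂ)) : Prop :=
  U ≠ ⊥ ∧ ∀ U' : Submodule ℂ (Fin d → ℂ), U' ≤ U → IsInvariant φ U' → U' = ⊥ ∨ U' = U

/-- Two `Γ`-invariant subspaces are isomorphic as `Γ`-modules: there is a `ℂ`-linear bijection
between them commuting with the action of every `φ γ`. -/
def IsoAsRep {d : ℕ} (φ : Representation ℂ Γ (Fin d → ℂ))
    (U₁ U₂ : Submodule ℂ (Fin d → ℂ)) : Prop :=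
  ∃ e : U₁ ≃ₗ[ℂ] U₂, ∀ (γ : Γ) (x : Fin d → ℂ) (hx : x ∈ U₁) (hγx : φ γ x ∈ U₁),
    ((e ⟨φ γ x, hγx⟩ : U₂) : Fin d → ℂ) = φ γ ((e ⟨x, hx⟩ : U₂) : Fin d → ℂ)

/-- `Fix(φ)`: the set of pairs `(V, W)` of `Γ`-invariant subspaces of `ℂ^d` with
`dim V = n`, `dim W = n + m`, `V ∩ W = 0` and `V + W = ℂ^d`. -/
def FixSet (n m : ℕ) {d : ℕ} (φ : Representation ℂ Γ (Fin d → ℂ)) :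
    Set (Submodule ℂ (Fin d → ℂ) × Submodule ℂ (Fin d → ℂ)) :=
  {p | IsInvariant φ p.1 ∧ IsInvariant φ p.2 ∧
    finrank ℂ p.1 = n ∧ finrank ℂ p.2 = n + m ∧ p.1 ⊓ p.2 = ⊥ ∧ p.1 ⊔ p.2 = ⊤}

/-- Condition (★): for every subset `I` of the index set with `∑_{i ∈ I} n_i = n`, the
constituents `U_i`, `i ∈ I`, and `U_j`, `j ∉ I`, are pairwise non-isomorphic. -/
def StarCondition {k : ℕ} (n : ℕ) (nι : Fin k → ℕ) {d : ℕ}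
    (φ : Representation ℂ Γ (Fin d → ℂ)) (U : Fin k → Submodule ℂ (Fin d → ℂ)) : Prop :=
  ∀ I : Finset (Fin k), (∑ i ∈ I, nι i) = n →
    ∀ i ∈ I, ∀ j ∉ I, ¬ IsoAsRep φ (U i) (U j)

theorem IsInvariant.iSup {d : ℕ} {φ : Representation ℂ Γ (Fin d → ℂ)} {ι : Sort*}
    {U : ι → Submodule ℂ (Fin d → ℂ)} (h : ∀ i, IsInvariant φ (U i)) :
    IsInvariant φ (⨆ i, U i) := by
  intro γ
  change (⨆ i, U i) ≤ (⨆ i, U i).comap (φ γ)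
  exact iSup_le fun i x hx => Submodule.mem_iSup_of_mem i (h i γ x hx)

theorem _root_.iSupIndep.finrank_biSup_finset {K E ι : Type*} [DivisionRing K] [AddCommGroup E]
    [Module K E] [FiniteDimensional K E] {U : ι → Submodule K E}
    (h : iSupIndep U) (s : Finset ι) :
    finrank K (⨆ i ∈ s, U i : Submodule K E) = ∑ i ∈ s, finrank K (U i) := by
  classical
  induction s using Finset.induction_on with
  | empty => simp
  | insert a s ha ih =>
    have hd : Disjoint (U a) (⨆ i ∈ s, U i) :=
      h.disjoint_biSup (y := (s : Set ι)) (by simpa using ha)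
    have := Submodule.finrank_sup_add_finrank_inf_eq (U a) (⨆ i ∈ s, U i)
    rw [hd.eq_bot, finrank_bot, add_zero, ih] at this
    rw [Finset.iSup_insert, Finset.sum_insert ha, this]

/-- Shearing `V` along an equivariant map into the complement `W` that does not vanish on `V`
gives infinitely many invariant complements of `W`. -/
theorem fixSet_infinite_of_equivariant {n m d : ℕ} {φ : Representation ℂ Γ (Fin d → ℂ)}
    {V W : Submodule ℂ (Fin d → ℂ)} (h : (V, W) ∈ FixSet n m φ)
    (N : (Fin d → ℂ) →ₗ[ℂ] (Fin d → ℂ)) (hN : ∀ γ x, N (φ γ x) = φ γ (N x))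
    (hNW : ∀ x, N x ∈ W) {v : Fin d → ℂ} (hv : v ∈ V) (hNv : N v ≠ 0) :
    (FixSet n m φ).Infinite := by
  obtain ⟨hV, hW, hVn, hWn, hinf, hsup⟩ := h
  dsimp only at hV hW hVn hWn hinf hsup
  have hzero : ∀ x ∈ V, x ∈ W → x = 0 := fun x hxV hxW => by
    have : x ∈ V ⊓ W := ⟨hxV, hxW⟩
    rwa [hinf, Submodule.mem_bot] at this
  let T : ℂ → (Fin d → ℂ) →ₗ[ℂ] (Fin d → ℂ) := fun t => LinearMap.id + t • N
  have hT : ∀ t x, T t x = x + t • N x := fun t x => rfl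
  have hTW : ∀ t, ∀ x ∈ V, T t x ∈ W → x = 0 := fun t x hx hxW =>
    hzero x hx ((W.add_mem_iff_left (W.smul_mem t (hNW x))).1 hxW)
  refine Set.infinite_of_injective_forall_mem (f := fun t : ℂ => (V.map (T t), W)) ?_ ?_
  · intro t s hts
    have hmem : T t v ∈ V.map (T s) := by
      rw [← (Prod.mk.inj hts).1]
      exact Submodule.mem_map_of_mem hv
    obtain ⟨x, hx, hxv⟩ := hmem
    rw [hT, hT] at hxv
    have hxv' : x - v = 0 := by
      refine hzero _ (V.sub_mem hx hv) ?_
      have : x - v = t • N v - s • N x := by linear_combination hxv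
      rw [this]
      exact W.sub_mem (W.smul_mem _ (hNW _)) (W.smul_mem _ (hNW _))
    rw [sub_eq_zero.1 hxv'] at hxv
    exact (smul_left_injective ℂ hNv (add_left_cancel hxv)).symm
  · intro t
    have hinf' : V.map (T t) ⊓ W = ⊥ := by
      refine (Submodule.eq_bot_iff _).2 ?_
      rintro _ ⟨⟨x, hx, rfl⟩, hxW⟩
      rw [hTW t x hx hxW, map_zero]
    have hsup' : V.map (T t) ⊔ W = ⊤ := by
      rw [eq_top_iff, ← hsup]
      refine sup_le (fun x hx => ?_) le_sup_right
      have : x = T t x + -(t • N x) := by rw [hT]; abel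
      rw [this]
      exact Submodule.add_mem_sup (Submodule.mem_map_of_mem hx)
        (W.neg_mem (W.smul_mem t (hNW x)))
    refine ⟨?_, hW, ?_, hWn, hinf', hsup'⟩
    · rintro γ _ ⟨x, hx, rfl⟩
      exact ⟨φ γ x, hV γ x hx, by simp [hT, hN]⟩
    · have h₁ := Submodule.finrank_add_eq_of_isCompl (IsCompl.of_eq hinf hsup)
      have h₂ := Submodule.finrank_add_eq_of_isCompl (IsCompl.of_eq hinf' hsup')
      dsimp only
      omega

theorem IsInvariant.projectionOnto_apply {d : ℕ} {φ : Representation ℂ Γ (Fin d → ℂ)}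
    {V W : Submodule ℂ (Fin d → ℂ)} (hV : IsInvariant φ V) (hW : IsInvariant φ W)
    (h : IsCompl V W) (γ : Γ) (x : Fin d → ℂ) :
    V.projectionOnto W h (φ γ x) = ⟨φ γ (V.projectionOnto W h x), hV γ _ (Subtype.prop _)⟩ := by
  obtain ⟨v, hv, w, hw, rfl⟩ := Submodule.mem_sup.1 (h.sup_eq_top ▸ Submodule.mem_top (x := x))
  rw [map_add (φ γ)]
  have hv' := Submodule.projectionOnto_apply_left h ⟨v, hv⟩
  have hγv := Submodule.projectionOnto_apply_left h ⟨φ γ v, hV γ v hv⟩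
  have hw' := Submodule.projectionOnto_apply_of_mem_right h hw
  have hγw := Submodule.projectionOnto_apply_of_mem_right h (hW γ w hw)
  dsimp only at hv' hγv
  ext1
  simp [hv', hγv, hw', hγw]

/-- If condition (★) fails, i.e. there are a subset `I` with `∑_{i ∈ I} n_i = n` and indices
`i ∈ I`, `j ∉ I` with `U_i ≅ U_j` as `Γ`-modules, then `Fix(φ)` is infinite. -/
theorem fixSet_infinite_of_not_starCondition {n m k : ℕ} (hn : 1 ≤ n)
    (φ : Representation ℂ Γ (Fin (2 * n + m) → ℂ))
    (U : Fin k → Submodule ℂ (Fin (2 * n + m) → ℂ)) (nι : Fin k → ℕ)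
    (hinv : ∀ i, IsInvariant φ (U i)) (hirr : ∀ i, IsIrreducibleInv φ (U i))
    (hsum : DirectSum.IsInternal U)
    (hdim : ∀ i, finrank ℂ (U i) = nι i)
    (I : Finset (Fin k)) (hI : (∑ i ∈ I, nι i) = n)
    (i j : Fin k) (hi : i ∈ I) (hj : j ∉ I) (hiso : IsoAsRep φ (U i) (U j)) :
    (FixSet n m φ).Infinite := by
  have hind := hsum.submodule_iSupIndep
  have htop := hsum.submodule_iSup_eq_top
  have hcompl : IsCompl (U i) (⨆ l, ⨆ _ : l ≠ i, U l) := by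
    refine ⟨hind i, codisjoint_iff_le_sup.2 ?_⟩
    rw [← htop]
    refine iSup_le fun l => ?_
    by_cases hl : l = i
    · exact hl ▸ le_sup_left
    · exact le_sup_of_le_right (le_iSup₂_of_le l hl le_rfl)
  have hVW : IsCompl (⨆ l ∈ I, U l) (⨆ l ∈ Iᶜ, U l) := by
    refine ⟨?_, codisjoint_iff_le_sup.2 ?_⟩
    · exact hind.disjoint_biSup_biSup
        (s := (I : Set (Fin k))) (t := (↑Iᶜ : Set (Fin k))) (by simp [disjoint_compl_right])
    · rw [← htop]
      refine iSup_le fun l => ?_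
      by_cases hl : l ∈ I
      · exact le_sup_of_le_left (le_iSup₂_of_le l hl le_rfl)
      · exact le_sup_of_le_right (le_iSup₂_of_le l (Finset.mem_compl.2 hl) le_rfl)
  have hfin : finrank ℂ (⨆ l ∈ I, U l : Submodule ℂ (Fin (2 * n + m) → ℂ)) = n := by
    rw [hind.finrank_biSup_finset]
    exact (Finset.sum_congr rfl fun l _ => hdim l).trans hI
  have hadd := Submodule.finrank_add_eq_of_isCompl hVW
  rw [hfin, finrank_fin_fun] at hadd
  obtain ⟨e, he⟩ := hiso
  obtain ⟨v, hv, hv0⟩ := (Submodule.ne_bot_iff _).1 (hirr i).1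
  have hinv' : IsInvariant φ (⨆ l, ⨆ _ : l ≠ i, U l) := .iSup fun l => .iSup fun _ => hinv l
  refine fixSet_infinite_of_equivariant (V := ⨆ l ∈ I, U l) (W := ⨆ l ∈ Iᶜ, U l)
    ⟨.iSup fun l => .iSup fun _ => hinv l, .iSup fun l => .iSup fun _ => hinv l, hfin,
      by dsimp only; omega, hVW.inf_eq_bot, hVW.sup_eq_top⟩
    ((U j).subtype ∘ₗ e.toLinearMap ∘ₗ (U i).projectionOnto _ hcompl) (fun γ x => ?_)
    (fun x => ?_) (v := v) ?_ ?_
  · simp only [LinearMap.comp_apply, (hinv i).projectionOnto_apply hinv' hcompl]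
    exact he γ _ (Subtype.prop _) _
  · exact Submodule.mem_iSup_of_mem j
      (Submodule.mem_iSup_of_mem (Finset.mem_compl.2 hj) (Subtype.prop _))
  · exact Submodule.mem_iSup_of_mem i (Submodule.mem_iSup_of_mem hi hv)
  · lift v to U i using hv
    simpa using hv0

end BZSVFix
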